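/- arXiv:2402.17428 — 3 statements merged into one kernel-verified Lean document; each statement's English description precedes it below -/
import Mathlib

section
/- For every nonempty string T, the shortest cover cov(T) is superprimitive (i.e., cov(cov(T)) = cov(T)) and non-periodic (i.e., 2·per(cov(T)) > |cov(T)|). (Lemma 2, item 2.) -/
variable {α : Type*}

/-- `v` occurs at (1-indexed) position `i` in `S`. -/
def occursAt (v S : List α) (i : ℕ) : Prop :=
  1 ≤ i ∧ i + v.length ≤ S.length + 1 ∧ (S.drop (i - 1)).take v.length = v

/-- `v` is a cover of `S`: every position of `S` lies within some occurrence of `v`. -/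
def isCover (v S : List α) : Prop :=
  ∀ p : ℕ, 1 ≤ p → p ≤ S.length → ∃ i : ℕ, occursAt v S i ∧ i ≤ p ∧ p < i + v.length

/-- `b` is a border of `S`: a proper prefix and a proper suffix of `S`. -/
def isBorder (b S : List α) : Prop :=
  b.length < S.length ∧ b <+: S ∧ b <:+ S

/-- `p` is a period of `S`: `S[i] = S[i+p]` for all `1 ≤ i ≤ |S| - p` (1-indexed). -/
def isPeriod (p : ℕ) (S : List α) : Prop :=
  1 ≤ p ∧ ∀ i : ℕ, ∀ h : i + p < S.length, S[i]'(by omega) = S[i + p]'h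

/-- the smallest period of `S` -/
noncomputable def per (S : List α) : ℕ := sInf {p | isPeriod p S}

/-- `c` is the shortest cover of `S`. -/
def isShortestCover (c S : List α) : Prop :=
  isCover c S ∧ ∀ c' : List α, isCover c' S → c.length ≤ c'.length

/-- `b` is the longest border of `S`. -/
def isLongestBorder (b S : List α) : Prop :=
  isBorder b S ∧ ∀ b' : List α, isBorder b' S → b'.length ≤ b.length

/-- `r` is the length of the longest common prefix of `X` and `Y`. -/
def isLCPLen (X Y : List α) (r : ℕ) : Prop :=
  r ≤ X.length ∧ r ≤ Y.length ∧ X.take r = Y.take r ∧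
  ∀ r' : ℕ, r' ≤ X.length → r' ≤ Y.length → X.take r' = Y.take r' → r' ≤ r

/-- `l` is the length of the longest prefix of `S` having period `p`. -/
def isLongestPeriodicPrefixLen (p : ℕ) (S : List α) (l : ℕ) : Prop :=
  l ≤ S.length ∧ isPeriod p (S.take l) ∧
  ∀ l' : ℕ, l' ≤ S.length → isPeriod p (S.take l') → l' ≤ l

theorem occursAt_self {S : List α} : occursAt S S 1 := by
  simp [occursAt, Nat.add_comm]

theorem isCover_self (S : List α) : isCover S S :=
  fun p hp hpS => ⟨1, occursAt_self, hp, by omega⟩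

theorem occursAt_trans {u v S : List α} {i j : ℕ} (hu : occursAt u v j) (hv : occursAt v S i) :
    occursAt u S (i + j - 1) := by
  obtain ⟨hj, hjl, hju⟩ := hu
  obtain ⟨hi, hil, hiv⟩ := hv
  refine ⟨by omega, by omega, ?_⟩
  calc (S.drop (i + j - 1 - 1)).take u.length
      = (((S.drop (i - 1)).take v.length).drop (j - 1)).take u.length := by
        rw [List.drop_take, List.take_take, List.drop_drop]
        congr 2 <;> omega
    _ = u := by rw [hiv, hju]

theorem isCover_trans {u v S : List α} (hu : isCover u v) (hv : isCover v S) : isCover u S := by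
  intro p hp hpS
  obtain ⟨i, hi, hip, hpi⟩ := hv p hp hpS
  obtain ⟨j, hj, hjp, hpj⟩ := hu (p - i + 1) (by omega) (by omega)
  have := hi.1
  have := hj.1
  exact ⟨i + j - 1, occursAt_trans hj hi, by omega, by omega⟩

theorem isCover.ne_nil {v S : List α} (h : isCover v S) (hS : S ≠ []) : v ≠ [] := by
  rintro rfl
  obtain ⟨i, -, hi, hi'⟩ := h 1 le_rfl (List.length_pos_iff.mpr hS)
  simp only [List.length_nil] at hi'
  omega

theorem isPeriod_per {S : List α} (hS : S ≠ []) : isPeriod (per S) S :=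
  Nat.sInf_mem (s := {p | isPeriod p S})
    ⟨S.length, List.length_pos_iff.mpr hS, fun i h => absurd h (by omega)⟩

theorem isPeriod.take_eq_drop {p : ℕ} {S : List α} (h : isPeriod p S) :
    S.take (S.length - p) = S.drop p := by
  apply List.ext_getElem
  · simp
  · intro i h₁ h₂
    rw [List.length_drop] at h₂
    simpa [Nat.add_comm] using h.2 i (by omega)

theorem isPeriod.isCover_take {p : ℕ} {S : List α} (h : isPeriod p S) (hp : 2 * p ≤ S.length) :
    isCover (S.take (S.length - p)) S := by
  have hlen : (S.take (S.length - p)).length = S.length - p := by simp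
  intro q hq hqS
  by_cases hqp : q ≤ S.length - p
  · refine ⟨1, ⟨le_rfl, by omega, by simp⟩, hq, by omega⟩
  · refine ⟨p + 1, ⟨by omega, by omega, ?_⟩, by omega, by omega⟩
    rw [hlen, h.take_eq_drop, Nat.add_sub_cancel]
    exact List.take_of_length_le (by simp)

/-- Lemma 2, item 2: the shortest cover of a nonempty string is superprimitive
and non-periodic. -/
theorem stmt1 (T : List α) (hT : T ≠ []) (c : List α) (hc : isShortestCover c T) :
    isShortestCover c c ∧ c.length < 2 * per c := by
  obtain ⟨hcT, hmin⟩ := hc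
  refine ⟨⟨isCover_self c, fun u hu => hmin u (isCover_trans hu hcT)⟩, ?_⟩
  by_contra! hper
  have hp := isPeriod_per (hcT.ne_nil hT)
  have hle := hmin _ (isCover_trans (hp.isCover_take hper) hcT)
  have := hp.1
  simp only [List.length_take] at hle
  omega
end

section
/- Let T' be a string, R a proper suffix of T', and b a nonempty string such that bR is a border of T'. Suppose b is periodic with smallest period p = per(b) (so 2p ≤ |b|) and per(bR) ≠ p. Let l be the length of the longest prefix of T' having period p, and let r = lcp( T'[|T'|−|R|−p+1 .. |T'|], T'[|T'|−|R|+1 .. |T'|] ). Then |b| = l − r. (Lemma 6.) -/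
variable {α : Type*}

theorem isPeriod_iff_getElem? (p : ℕ) (S : List α) :
    isPeriod p S ↔ 1 ≤ p ∧ ∀ i, i + p < S.length → S[i]? = S[i + p]? := by
  refine and_congr_right fun _ => forall_congr' fun i => forall_congr' fun h => ?_
  rw [List.getElem?_eq_getElem h, List.getElem?_eq_getElem (by omega), Option.some_inj]

theorem isPeriod.of_prefix {p : ℕ} {U S : List α} (h : isPeriod p S) (hU : U <+: S) :
    isPeriod p U := by
  obtain ⟨V, rfl⟩ := hU
  refine ⟨h.1, fun i hi => ?_⟩
  have := h.2 i (by rw [List.length_append]; omega)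
  rwa [List.getElem_append_left (by omega), List.getElem_append_left hi] at this

theorem per_le {p : ℕ} {S : List α} (h : isPeriod p S) : per S ≤ p :=
  Nat.sInf_le h

/-- If the smallest period of a nonempty prefix of `S` is a period of `S`, then it is the
smallest period of `S`. -/
theorem per_eq_of_prefix {U S : List α} (hU : U <+: S) (hne : U ≠ [])
    (h : isPeriod (per U) S) : per S = per U := by
  have hS : S ≠ [] := fun hS => hne (List.prefix_nil.mp (hS ▸ hU))
  exact le_antisymm (per_le h) (per_le ((isPeriod_per hS).of_prefix hU))

/-- The period `p` of `b` extends to `k` further letters of `R` exactly when `R` and the last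
`p` letters of `b` followed by `R` agree on their first `k` letters. -/
theorem isPeriod_append_take_iff {p k : ℕ} {b R : List α} (hb : isPeriod p b)
    (hp : p ≤ b.length) (hk : k ≤ R.length) :
    isPeriod p ((b ++ R).take (b.length + k)) ↔
      ((b ++ R).drop (b.length - p)).take k = R.take k := by
  rw [isPeriod_iff_getElem?] at *
  have hlen : ((b ++ R).take (b.length + k)).length = b.length + k := by
    simp only [List.length_take, List.length_append]; omega
  rw [hlen]
  constructor
  · rintro ⟨-, h⟩
    apply List.ext_getElem?
    intro i
    by_cases hi : i < k
    · have := h (b.length - p + i) (by omega)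
      rw [List.getElem?_take_of_lt (by omega), List.getElem?_take_of_lt (by omega),
        show b.length - p + i + p = b.length + i by omega,
        List.getElem?_append_right (l₁ := b) (i := b.length + i) (by omega),
        Nat.add_sub_cancel_left] at this
      rw [List.getElem?_take_of_lt hi, List.getElem?_take_of_lt hi, List.getElem?_drop, this]
    · rw [List.getElem?_take_eq_none (by omega), List.getElem?_take_eq_none (by omega)]
  · refine fun h => ⟨hb.1, fun i hi => ?_⟩
    rw [List.getElem?_take_of_lt (by omega), List.getElem?_take_of_lt hi]
    by_cases hib : i + p < b.length
    · rw [List.getElem?_append_left (by omega), List.getElem?_append_left hib]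
      exact hb.2 i hib
    · have := congrArg (fun L => L[i + p - b.length]?) h
      rw [List.getElem?_take_of_lt (by omega), List.getElem?_take_of_lt (by omega),
        List.getElem?_drop, show b.length - p + (i + p - b.length) = i by omega] at this
      rw [this, List.getElem?_append_right (by omega)]

/-- Lemma 6: if `bR` is a border of `T'` with `b` periodic of smallest period
`p` and `per (bR) ≠ p`, then `|b| = l - r`, where `l` is the length of the
longest prefix of `T'` with period `p` and
`r = lcp(T'[|T'|-|R|-p+1 .. |T'|], T'[|T'|-|R|+1 .. |T'|])`. -/
theorem stmt11 (T' R b : List α) (hR : R <:+ T') (hRlen : R.length < T'.length)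
    (hbne : b ≠ []) (hbord : isBorder (b ++ R) T')
    (p : ℕ) (hp : per b = p) (hperiodic : 2 * p ≤ b.length)
    (hpbR : per (b ++ R) ≠ p)
    (l : ℕ) (hl : isLongestPeriodicPrefixLen p T' l)
    (r : ℕ)
    (hr : isLCPLen (T'.drop (T'.length - R.length - p)) (T'.drop (T'.length - R.length)) r) :
    b.length + r = l := by
  have hb : isPeriod p b := hp ▸ isPeriod_per hbne
  obtain ⟨-, hpre, V, rfl⟩ := hbord
  have hn : (V ++ (b ++ R)).length = V.length + b.length + R.length := by
    simp only [List.length_append]; omega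
  obtain ⟨hrX, hrR, hreq, hrmax⟩ := hr
  obtain ⟨hlT, hlper, hlmax⟩ := hl
  have hX : (V ++ (b ++ R)).drop ((V ++ (b ++ R)).length - R.length - p) =
      (b ++ R).drop (b.length - p) := by
    rw [hn, show V.length + b.length + R.length - R.length - p
      = V.length + (b.length - p) by omega, List.drop_append]
    simp
  have hY : (V ++ (b ++ R)).drop ((V ++ (b ++ R)).length - R.length) = R := by
    rw [hn, show V.length + b.length + R.length - R.length = V.length + b.length by omega,
      ← List.append_assoc]
    exact List.drop_left' (by simp)
  rw [hX, hY] at hreq hrmax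
  rw [hX] at hrX
  rw [hY] at hrR
  have htake : ∀ k ≤ R.length, (V ++ (b ++ R)).take (b.length + k) =
      (b ++ R).take (b.length + k) := fun k hk => by
    obtain ⟨W, hW⟩ := hpre
    rw [← hW, List.take_append_of_le_length (by rw [List.length_append]; omega)]
  have hbl : b.length ≤ l := by
    refine hlmax _ (by omega) ?_
    have h0 := htake 0 (Nat.zero_le _)
    rw [Nat.add_zero, List.take_left] at h0
    rwa [h0]
  have hlb : l ≤ b.length + R.length := by
    by_contra! hlt
    refine hpbR (hp ▸ per_eq_of_prefix (List.prefix_append b R) hbne ?_)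
    rw [hp]
    exact hlper.of_prefix (List.prefix_take_iff.mpr
      ⟨hpre, by rw [List.length_append]; omega⟩)
  obtain ⟨k, rfl⟩ := Nat.exists_eq_add_of_le hbl
  have hkR : k ≤ R.length := by omega
  refine le_antisymm (hlmax _ (by omega) ?_) (Nat.add_le_add_left (hrmax k ?_ hkR ?_) _)
  · rw [htake r hrR]
    exact (isPeriod_append_take_iff hb (by omega) hrR).mpr hreq
  · simp only [List.length_drop, List.length_append]; omega
  · rw [htake k hkR] at hlper
    exact (isPeriod_append_take_iff hb (by omega) hkR).mp hlper
end

section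
/- Let u and v be strings with uv nonempty, let S = uvuvu, and suppose per(S) = |uv|. Suppose uvu has a nonempty longest border and let x = cov(bord(uvu)). Let m be an integer with 2m ≥ |S| and m < |uvu|, and let r be the largest integer with r ≤ m such that x is a cover of S[1..r]. Then x is a cover of uvu if and only if r ≥ |uvu| − max(|u|, |x|). (Lemma 11.) -/
variable {α : Type*}

theorem occursAt_succ_iff {v S : List α} {k : ℕ} (hk : k ≤ S.length) :
    occursAt v S (k + 1) ↔ v <+: S.drop k := by
  rw [occursAt, List.prefix_iff_eq_take, Nat.add_sub_cancel]
  constructor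
  · rintro ⟨-, -, h⟩
    exact h.symm
  · intro h
    have h' := congrArg List.length h
    simp only [List.length_take, List.length_drop] at h'
    exact ⟨by omega, by omega, h.symm⟩

/-- Covers in terms of 0-indexed offsets. -/
theorem isCover_iff {v S : List α} :
    isCover v S ↔ ∀ p < S.length, ∃ k, v <+: S.drop k ∧ k ≤ p ∧ p < k + v.length := by
  constructor
  · intro h p hp
    obtain ⟨i, hi, hip, hpi⟩ := h (p + 1) (by omega) (by omega)
    obtain ⟨k, rfl⟩ : ∃ k, i = k + 1 := ⟨i - 1, by have := hi.1; omega⟩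
    exact ⟨k, (occursAt_succ_iff (by omega)).1 hi, by omega, by omega⟩
  · intro h p hp hpS
    obtain ⟨k, hk, hkp, hpk⟩ := h (p - 1) (by omega)
    exact ⟨k + 1, (occursAt_succ_iff (by omega)).2 hk, by omega, by omega⟩

theorem isPrefix_drop_trans {v w S : List α} {a b : ℕ} (hv : v <+: w.drop a)
    (hw : w <+: S.drop b) : v <+: S.drop (b + a) := by
  rw [← List.drop_drop]
  exact hv.trans (hw.drop a)

theorem isCover.trans {v w S : List α} (hv : isCover v w) (hw : isCover w S) : isCover v S := by
  rw [isCover_iff] at *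
  intro p hp
  obtain ⟨k, hk, hkp, hpk⟩ := hw p hp
  obtain ⟨l, hl, hlp, hpl⟩ := hv (p - k) (by omega)
  exact ⟨k + l, isPrefix_drop_trans hl hk, by omega, by omega⟩

theorem isCover.isPrefix {v S : List α} (h : isCover v S) (hS : S ≠ []) : v <+: S := by
  obtain ⟨k, hk, hk0, -⟩ := isCover_iff.1 h 0 (List.length_pos_iff.2 hS)
  obtain rfl : k = 0 := by omega
  simpa using hk

theorem isCover.isSuffix {v S : List α} (h : isCover v S) (hS : S ≠ []) : v <:+ S := by
  have hpos := List.length_pos_iff.2 hS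
  obtain ⟨k, hk, hk1, hk2⟩ := isCover_iff.1 h (S.length - 1) (by omega)
  have hle := hk.length_le
  rw [List.length_drop] at hle
  rw [hk.eq_of_length (by rw [List.length_drop]; omega)]
  exact List.drop_suffix _ _

/-- Cutting a covered string right after an occurrence of the cover leaves a covered string. -/
theorem isCover.take {v S : List α} (h : isCover v S) {k : ℕ} (hk : v <+: S.drop k) :
    isCover v (S.take (k + v.length)) := by
  rw [isCover_iff] at *
  intro p hp
  rw [List.length_take] at hp
  obtain ⟨l, hl, hlp, hpl⟩ := h p (by omega)
  rcases le_total l k with hlk | hlk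
  · refine ⟨l, ?_, hlp, hpl⟩
    rw [List.drop_take, List.prefix_take_iff]
    exact ⟨hl, by omega⟩
  · refine ⟨k, ?_, by omega, by omega⟩
    rw [List.drop_take, List.prefix_take_iff]
    exact ⟨hk, by omega⟩

/-- Two occurrences of `x` at distance `d ≤ |x| / 2` give a cover of `x` of length `|x| - d`. -/
theorem isCover_drop_of_overlap {x S : List α} {k d : ℕ} (h₁ : x <+: S.drop k)
    (h₂ : x <+: S.drop (k + d)) (hd : 2 * d ≤ x.length) : isCover (x.drop d) x := by
  have hpre : x.drop d <+: x := by
    refine List.prefix_of_prefix_length_le (h₁.drop d) ?_ (by simp)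
    rwa [List.drop_drop]
  rw [isCover_iff]
  intro p hp
  rw [List.length_drop]
  rcases lt_or_ge p (x.length - d) with hlt | hge
  · exact ⟨0, by simpa using hpre, by omega, by omega⟩
  · exact ⟨d, List.prefix_rfl, by omega, by omega⟩

theorem isPrefix_drop_of_isSuffix {w S : List α} (h : w <:+ S) :
    w <+: S.drop (S.length - w.length) := by
  rw [← List.suffix_iff_eq_drop.1 h]

/-- A covered prefix and a covered suffix that together exhaust `S` make `S` covered. -/
theorem isCover_of_take_of_isSuffix {v w S : List α} {r : ℕ} (hr : isCover v (S.take r))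
    (hw : isCover v w) (hwS : w <:+ S) (hlen : S.length ≤ r + w.length) : isCover v S := by
  have hle := hwS.length_le
  have hdrop := isPrefix_drop_of_isSuffix hwS
  rw [isCover_iff] at *
  intro p hp
  rcases lt_or_ge p r with hlt | hge
  · obtain ⟨k, hk, hkp, hpk⟩ := hr p (by rw [List.length_take]; omega)
    rw [List.drop_take, List.prefix_take_iff] at hk
    exact ⟨k, hk.1, hkp, hpk⟩
  · obtain ⟨l, hl, hlp, hpl⟩ := hw (p - (S.length - w.length)) (by omega)
    exact ⟨_, isPrefix_drop_trans hl hdrop, by omega, by omega⟩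

/-- Lemma 11: with `S = uvuvu`, `per S = |uv|`, `x = cov(bord(uvu))`, `m` with
`2m ≥ |S|` and `m < |uvu|`, and `r` the largest integer `≤ m` such that `x`
covers `S[1..r]`, the string `x` covers `uvu` iff `r ≥ |uvu| - max(|u|, |x|)`. -/
theorem stmt15 (u v : List α) (huv : u ++ v ≠ [])
    (hper : per (u ++ v ++ u ++ v ++ u) = (u ++ v).length)
    (B : List α) (hB : isLongestBorder B (u ++ v ++ u)) (hBne : B ≠ [])
    (x : List α) (hx : isShortestCover x B)
    (m : ℕ) (hm₁ : (u ++ v ++ u ++ v ++ u).length ≤ 2 * m)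
    (hm₂ : m < (u ++ v ++ u).length)
    (r : ℕ) (hr₁ : r ≤ m)
    (hr₂ : isCover x ((u ++ v ++ u ++ v ++ u).take r))
    (hrmax : ∀ r' : ℕ, r' ≤ m → isCover x ((u ++ v ++ u ++ v ++ u).take r') → r' ≤ r) :
    isCover x (u ++ v ++ u) ↔ (u ++ v ++ u).length ≤ r + max u.length x.length := by
  have hUS : u ++ v ++ u <+: u ++ v ++ u ++ v ++ u := ⟨v ++ u, by simp⟩
  have huP : u <+: u ++ v ++ u := ⟨v ++ u, by simp⟩
  have huS : u <:+ u ++ v ++ u := List.suffix_append _ _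
  have hpos : 0 < (u ++ v).length := List.length_pos_iff.2 huv
  have hlen : (u ++ v ++ u).length = (u ++ v).length + u.length := List.length_append
  have hlenS : (u ++ v ++ u ++ v ++ u).length = 2 * (u ++ v).length + u.length := by
    simp only [List.length_append]
    omega
  rw [hlenS] at hm₁
  have htake : ∀ k ≤ (u ++ v ++ u).length,
      (u ++ v ++ u ++ v ++ u).take k = (u ++ v ++ u).take k := by
    intro k hk
    conv_rhs => rw [List.prefix_iff_eq_take.1 hUS, List.take_take, min_eq_left hk]
  rw [htake r (by omega)] at hr₂
  replace hrmax : ∀ k ≤ m, isCover x ((u ++ v ++ u).take k) → k ≤ r := fun k hk h =>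
    hrmax k hk (by rwa [htake k (by omega)])
  clear hUS htake hlenS hper
  generalize u ++ v ++ u = U at *
  obtain ⟨⟨hBlt, hBP, hBS⟩, hBmax⟩ := hB
  have huB : u.length ≤ B.length := hBmax u ⟨by omega, huP, huS⟩
  have hxP : x <+: B := hx.1.isPrefix hBne
  have hxS : x <:+ B := hx.1.isSuffix hBne
  have hxB := hxP.length_le
  constructor
  · intro hcov
    by_contra! hlt
    obtain ⟨q, hq⟩ : ∃ q, q + max u.length x.length = U.length :=
      ⟨_, Nat.sub_add_cancel (by omega)⟩
    have hxq : x <+: U.drop q := by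
      rcases le_total u.length x.length with hle | hle
      · have := isPrefix_drop_of_isSuffix (hxS.trans hBS)
        rwa [show U.length - x.length = q by omega] at this
      · have := isPrefix_drop_of_isSuffix huS
        rw [show U.length - u.length = q by omega] at this
        exact (List.prefix_of_prefix_length_le (hxP.trans hBP) huP hle).trans this
    obtain ⟨k, hk, hkq, hqk⟩ := isCover_iff.1 hcov (q - 1) (by omega)
    have hend : m < k + x.length := by
      by_contra! hle
      have := hrmax _ hle (hcov.take hk)
      omega
    have hdrop := isCover_drop_of_overlap (d := q - k) hk
      (by rwa [Nat.add_sub_cancel' (by omega)]) (by omega)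
    have := hx.2 _ (hdrop.trans hx.1)
    rw [List.length_drop] at this
    omega
  · intro hle
    exact isCover_of_take_of_isSuffix hr₂ hx.1 hBS (by omega)
end
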